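/- arXiv:2106.15675 — 5 statements merged into one kernel-verified Lean document; each statement's English description precedes it below -/
import Mathlib

section
/- Viewing M_k as a polynomial in the two variables μ and v (e.g. as an element of MvPolynomial (Fin 2) ℝ), the partial derivatives satisfy: for every k ≥ 1, ∂M_k/∂μ = k·M_{k−1}, and for every k ≥ 2, ∂M_k/∂v = (k choose 2)·M_{k−2}. -/
open MvPolynomial

/-- The Gaussian moment polynomials as bivariate polynomials in `μ = X 0` and `v = X 1`:
`M 0 = 1`, `M 1 = μ`, and `M i = μ * M (i-1) + (i-1) * v * M (i-2)` for `i ≥ 2`. -/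
noncomputable def gaussMomentPoly : ℕ → MvPolynomial (Fin 2) ℝ
  | 0 => 1
  | 1 => X 0
  | (n + 2) => X 0 * gaussMomentPoly (n + 1) + C ((n : ℝ) + 1) * X 1 * gaussMomentPoly n

theorem gaussMomentPoly_add_two (n : ℕ) :
    gaussMomentPoly (n + 2) =
      X 0 * gaussMomentPoly (n + 1) +
        ((n : MvPolynomial (Fin 2) ℝ) + 1) * X 1 * gaussMomentPoly n := by
  simp [gaussMomentPoly]

theorem pderiv_zero_gaussMomentPoly_succ (n : ℕ) :
    pderiv (0 : Fin 2) (gaussMomentPoly (n + 1)) =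
      ((n : MvPolynomial (Fin 2) ℝ) + 1) * gaussMomentPoly n := by
  induction n using Nat.twoStepInduction with
  | zero => simp [gaussMomentPoly]
  | one =>
    simp [gaussMomentPoly]
    ring
  | more n ih₀ ih₁ =>
    rw [gaussMomentPoly_add_two (n + 1)]
    simp only [map_add, Derivation.leibniz, smul_eq_mul, Derivation.map_natCast,
      Derivation.map_one_eq_zero, pderiv_X_self, pderiv_X_of_ne (zero_ne_one' (Fin 2)).symm,
      ih₀, ih₁]
    rw [gaussMomentPoly_add_two n]
    push_cast
    ring

theorem add_three_mul_choose_two (n : ℕ) :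
    (n + 3) * (n + 2).choose 2 = (n + 3).choose 2 * (n + 1) := by
  rw [← Nat.choose_symm_add (a := n) (b := 2), ← Nat.choose_symm_add (a := n + 1) (b := 2)]
  exact Nat.add_one_mul_choose_eq (n + 2) n

theorem pderiv_one_gaussMomentPoly_add_two (n : ℕ) :
    pderiv (1 : Fin 2) (gaussMomentPoly (n + 2)) =
      ((n + 2).choose 2 : MvPolynomial (Fin 2) ℝ) * gaussMomentPoly n := by
  induction n using Nat.twoStepInduction with
  | zero => simp [gaussMomentPoly]
  | one =>
    simp [gaussMomentPoly, Nat.choose]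
    ring
  | more n ih₀ ih₁ =>
    have hpascal : ((n + 4).choose 2 : MvPolynomial (Fin 2) ℝ) = (n + 3) + (n + 3).choose 2 := by
      rw [Nat.choose_succ_succ' (n + 3) 1]
      simp
    have habsorb : ((n : MvPolynomial (Fin 2) ℝ) + 3) * (n + 2).choose 2 =
        (n + 3).choose 2 * (n + 1) := by
      exact_mod_cast add_three_mul_choose_two n
    rw [gaussMomentPoly_add_two (n + 2)]
    simp only [map_add, Derivation.leibniz, smul_eq_mul, Derivation.map_natCast,
      Derivation.map_one_eq_zero, pderiv_X_self, pderiv_X_of_ne (zero_ne_one' (Fin 2)),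
      ih₀, ih₁, hpascal]
    rw [gaussMomentPoly_add_two n]
    push_cast
    linear_combination X 1 * gaussMomentPoly n * habsorb

/-- The partial derivatives of the Gaussian moment polynomials satisfy
`∂M_k/∂μ = k * M_{k-1}` for `k ≥ 1` and `∂M_k/∂v = (k choose 2) * M_{k-2}` for `k ≥ 2`. -/
theorem pderiv_gaussMomentPoly :
    (∀ k : ℕ, 1 ≤ k →
      pderiv (0 : Fin 2) (gaussMomentPoly k) =
        (k : MvPolynomial (Fin 2) ℝ) * gaussMomentPoly (k - 1)) ∧
    (∀ k : ℕ, 2 ≤ k →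
      pderiv (1 : Fin 2) (gaussMomentPoly k) =
        (Nat.choose k 2 : MvPolynomial (Fin 2) ℝ) * gaussMomentPoly (k - 2)) := by
  constructor
  · rintro (_ | n) hk
    · omega
    · simpa using pderiv_zero_gaussMomentPoly_succ n
  · rintro (_ | _ | n) hk
    · omega
    · omega
    · exact pderiv_one_gaussMomentPoly_add_two n
end

section
/- Fix k ≥ 1 and real mixing weights λ_1, …, λ_k, each nonzero. Define the polynomial moment map F : ℝ^{2k} → ℝ^{2k} whose i-th coordinate (for i = 1, …, 2k) at the point (μ_1, s_1, …, μ_k, s_k) is Σ_{ℓ=1}^k λ_ℓ · M_i(μ_ℓ, s_ℓ). Then the set of points x ∈ ℝ^{2k} at which the total derivative of F is an invertible linear map is open and dense in ℝ^{2k}. (Consequently, for generic sample moments the λ-weighted moment system has finitely many solutions, i.e. the λ-weighted Gaussian k-mixture model is algebraically identifiable from the first 2k moments.) -/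
/-- The Gaussian moment polynomials: `M 0 = 1`, `M 1 = μ`,
and `M i = μ * M (i-1) + (i-1) * v * M (i-2)` for `i ≥ 2`. -/
noncomputable def gaussMoment {α : Type*} [CommRing α] : ℕ → α → α → α
  | 0, _, _ => 1
  | 1, μ, _ => μ
  | (n + 2), μ, v => μ * gaussMoment (n + 1) μ v + ((n : α) + 1) * v * gaussMoment n μ v

/-- A matrix of analytic functions has an analytic determinant. -/
theorem Matrix.analyticOnNhd_det {𝕜 E n : Type*} [NontriviallyNormedField 𝕜]
    [NormedAddCommGroup E] [NormedSpace 𝕜 E] [Fintype n] [DecidableEq n]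
    {A : E → Matrix n n 𝕜} {s : Set E} (hA : ∀ i j, AnalyticOnNhd 𝕜 (fun x => A x i j) s) :
    AnalyticOnNhd 𝕜 (fun x => (A x).det) s := by
  intro x hx
  simp only [Matrix.det_apply']
  exact Finset.analyticAt_fun_sum _ fun σ _ =>
    analyticAt_const.mul (Finset.analyticAt_fun_prod _ fun i _ => hA _ _ x hx)

/-- If an analytic map between real spaces of the same finite dimension has an injective
derivative at one point, then its derivative is bijective on a dense open set. -/
theorem AnalyticOnNhd.isOpen_dense_bijective_fderiv {E G : Type*}
    [NormedAddCommGroup E] [NormedSpace ℝ E] [FiniteDimensional ℝ E]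
    [NormedAddCommGroup G] [NormedSpace ℝ G] [FiniteDimensional ℝ G]
    (hdim : Module.finrank ℝ E = Module.finrank ℝ G) {f : E → G}
    (hf : AnalyticOnNhd ℝ f Set.univ) {x₀ : E} (hx₀ : Function.Injective (fderiv ℝ f x₀)) :
    IsOpen {x | Function.Bijective (fderiv ℝ f x)} ∧
      Dense {x | Function.Bijective (fderiv ℝ f x)} := by
  let b := Module.finBasisOfFinrankEq ℝ E hdim
  let c := Module.finBasis ℝ G
  let A := fun x => LinearMap.toMatrix b c (fderiv ℝ f x : E →ₗ[ℝ] G)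
  have hset : {x | Function.Bijective (fderiv ℝ f x)} = {x | (A x).det ≠ 0} := by
    ext x
    constructor
    · intro h
      exact ((LinearEquiv.ofBijective (fderiv ℝ f x : E →ₗ[ℝ] G) h).isUnit_det b c).ne_zero
    · intro h
      exact (LinearEquiv.ofIsUnitDet (isUnit_iff_ne_zero.mpr h)).bijective
  have hdet : AnalyticOnNhd ℝ (fun x => (A x).det) Set.univ := by
    refine Matrix.analyticOnNhd_det fun i j x hx => ?_
    have h : AnalyticAt ℝ (fun y => fderiv ℝ f y (b j)) x :=
      ((ContinuousLinearMap.apply ℝ G (b j)).analyticAt _).comp (hf.fderiv x hx)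
    have h' := ((c.coord i).toContinuousLinearMap.analyticAt _).comp h
    refine h'.congr (Filter.Eventually.of_forall fun y => ?_)
    simp [A, LinearMap.toMatrix_apply]
  have hbij : Function.Bijective (fderiv ℝ f x₀) :=
    ⟨hx₀, (LinearMap.injective_iff_surjective_of_finrank_eq_finrank
      (f := (fderiv ℝ f x₀ : E →ₗ[ℝ] G)) hdim).mp hx₀⟩
  have hne : (A x₀).det ≠ 0 := by
    change x₀ ∈ {x | (A x).det ≠ 0}
    rwa [← hset]
  rw [hset]
  refine ⟨isOpen_ne_fun hdet.continuous continuous_const, fun x => ?_⟩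
  by_contra hx
  have hev : (fun y => (A y).det) =ᶠ[nhds x] 0 := by
    filter_upwards [isClosed_closure.isOpen_compl.mem_nhds hx] with y hy
    by_contra h
    exact hy (subset_closure h)
  exact hne (hdet.eqOn_zero_of_preconnected_of_eventuallyEq_zero isPreconnected_univ
    (Set.mem_univ x) hev (Set.mem_univ x₀))

theorem gaussMoment_zero_right {α : Type*} [CommRing α] (μ : α) (n : ℕ) :
    gaussMoment n μ 0 = μ ^ n := by
  induction n using Nat.twoStepInduction with
  | zero => simp [gaussMoment]
  | one => simp [gaussMoment]
  | more n _ ih => rw [gaussMoment, ih]; ring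

theorem AnalyticAt.gaussMoment {𝕜 E : Type*} [NontriviallyNormedField 𝕜]
    [NormedAddCommGroup E] [NormedSpace 𝕜 E] {u w : E → 𝕜} {x : E}
    (hu : AnalyticAt 𝕜 u x) (hw : AnalyticAt 𝕜 w x) (n : ℕ) :
    AnalyticAt 𝕜 (fun y => gaussMoment n (u y) (w y)) x := by
  induction n using Nat.twoStepInduction with
  | zero => simpa only [_root_.gaussMoment] using analyticAt_const
  | one => simpa only [_root_.gaussMoment] using hu
  | more n ih₀ ih₁ =>
    simp only [_root_.gaussMoment]
    exact (hu.mul ih₁).add ((analyticAt_const.mul hw).mul ih₀)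

/-- The derivative of a Gaussian moment along a curve, at a point where the variance vanishes. -/
theorem HasDerivAt.gaussMoment_succ {u w : ℝ → ℝ} {a b t : ℝ} (hu : HasDerivAt u a t)
    (hw : HasDerivAt w b t) (hwt : w t = 0) (n : ℕ) :
    HasDerivAt (fun y => gaussMoment (n + 1) (u y) (w y))
      ((n + 1) * (a * u t ^ n + b / 2 * (n * u t ^ (n - 1)))) t := by
  induction n using Nat.twoStepInduction with
  | zero => simpa [gaussMoment] using hu
  | one =>
    have h := (hu.mul hu).add hw
    refine (h.congr_deriv ?_).congr_of_eventuallyEq (Filter.Eventually.of_forall fun y => ?_)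
    · simp; ring
    · simp [gaussMoment]
  | more n ih₀ ih₁ =>
    have h := (hu.mul ih₁).add ((hw.const_mul ((n + 1 : ℕ) + 1 : ℝ)).mul ih₀)
    refine (h.congr_deriv ?_).congr_of_eventuallyEq (Filter.Eventually.of_forall fun y => ?_)
    · simp only [hwt, gaussMoment_zero_right]
      simp
      ring
    · simp [gaussMoment]

open Polynomial in
/-- Values and derivatives at `k` distinct nodes are linearly independent functionals on the
polynomials of degree less than `2 * k`. -/
theorem Polynomial.hermite_functionals_independent {K ι : Type*} [Field K] [Fintype ι]
    {v : ι → K} (hv : Function.Injective v) {a b : ι → K}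
    (h : ∀ n < 2 * Fintype.card ι, ∑ l, (a l * v l ^ n + b l * (n * v l ^ (n - 1))) = 0) :
    a = 0 ∧ b = 0 := by
  classical
  have hpoly (p : K[X]) (hp : p.natDegree < 2 * Fintype.card ι) :
      ∑ l, (a l * p.eval (v l) + b l * p.derivative.eval (v l)) = 0 := by
    rw [p.as_sum_range_C_mul_X_pow' hp]
    simp only [derivative_sum, eval_finsetSum, Finset.mul_sum, ← Finset.sum_add_distrib]
    rw [Finset.sum_comm]
    refine Finset.sum_eq_zero fun n hn => ?_
    rw [← mul_zero (p.coeff n), ← h n (Finset.mem_range.mp hn), Finset.mul_sum]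
    refine Finset.sum_congr rfl fun l _ => ?_
    simp [derivative_X_pow]
    ring
  let q (j : ι) : K[X] := ∏ l ∈ Finset.univ.erase j, (X - C (v l))
  have hcard (j : ι) : (q j).natDegree + 1 = Fintype.card ι := by
    rw [natDegree_prod_of_monic _ _ fun l _ => monic_X_sub_C _]
    simp [Finset.card_erase_of_mem, Nat.sub_add_cancel (Fintype.card_pos_iff.mpr ⟨j⟩)]
  have hq (j l : ι) (hl : l ≠ j) : (q j).eval (v l) = 0 := by
    rw [eval_prod]
    exact Finset.prod_eq_zero (Finset.mem_erase.mpr ⟨hl, Finset.mem_univ l⟩) (by simp)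
  have hqj (j : ι) : (q j).eval (v j) ≠ 0 := by
    rw [eval_prod]
    refine Finset.prod_ne_zero_iff.mpr fun l hl => ?_
    simpa [sub_eq_zero] using fun h => Finset.ne_of_mem_erase hl (hv h).symm
  have hb (j : ι) : b j = 0 := by
    have hdeg : ((X - C (v j)) * q j ^ 2).natDegree < 2 * Fintype.card ι := by
      have h₁ := natDegree_mul_le (p := X - C (v j)) (q := q j ^ 2)
      have h₂ := natDegree_pow_le (p := q j) (n := 2)
      rw [natDegree_X_sub_C] at h₁
      have := hcard j
      omega
    have hs := hpoly _ hdeg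
    rw [Finset.sum_eq_single j (fun l _ hl => by simp [hq j l hl, derivative_pow])
      (by simp)] at hs
    simpa [hqj j, derivative_pow] using hs
  have ha (j : ι) : a j = 0 := by
    have hdeg : (q j ^ 2).natDegree < 2 * Fintype.card ι := by
      have h₂ := natDegree_pow_le (p := q j) (n := 2)
      have := hcard j
      omega
    have hs := hpoly _ hdeg
    rw [Finset.sum_eq_single j (fun l _ hl => by simp [hq j l hl, derivative_pow])
      (by simp)] at hs
    simpa [hqj j, hb j] using hs
  exact ⟨_root_.funext ha, _root_.funext hb⟩

/-- For the λ-weighted Gaussian `k`-mixture moment map `F : ℝ^{2k} → ℝ^{2k}`, whose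
`i`-th coordinate (for `i = 1, …, 2k`) at `(μ, s)` is `Σ_ℓ λ_ℓ M_i(μ_ℓ, s_ℓ)`, the set of points
where the total derivative is invertible is open and dense; hence the λ-weighted model is
algebraically identifiable from the first `2k` moments. -/
theorem lambdaWeighted_jacobian_generically_invertible (k : ℕ) (hk : 1 ≤ k)
    (lam : Fin k → ℝ) (hlam : ∀ ℓ, lam ℓ ≠ 0)
    (F : (Fin k → ℝ) × (Fin k → ℝ) → (Fin (2 * k) → ℝ))
    (hF : F = fun x i => ∑ ℓ, lam ℓ * gaussMoment (i.1 + 1) (x.1 ℓ) (x.2 ℓ)) :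
    IsOpen {x | Function.Bijective (fderiv ℝ F x)} ∧
      Dense {x | Function.Bijective (fderiv ℝ F x)} := by
  have hF_an : AnalyticOnNhd ℝ F Set.univ := by
    intro x _
    rw [hF, analyticAt_pi_iff]
    intro i
    refine Finset.analyticAt_fun_sum _ fun ℓ _ =>
      analyticAt_const.mul (AnalyticAt.gaussMoment ?_ ?_ _)
    · exact ((ContinuousLinearMap.proj ℓ).comp
        (ContinuousLinearMap.fst ℝ (Fin k → ℝ) (Fin k → ℝ))).analyticAt x
    · exact ((ContinuousLinearMap.proj ℓ).comp
        (ContinuousLinearMap.snd ℝ (Fin k → ℝ) (Fin k → ℝ))).analyticAt x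
  let μ : Fin k → ℝ := fun ℓ => (ℓ : ℝ)
  have hμ : Function.Injective μ := fun _ _ h => Fin.ext (Nat.cast_injective h)
  refine hF_an.isOpen_dense_bijective_fderiv (x₀ := (μ, 0)) (by simp [two_mul]) ?_
  rw [injective_iff_map_eq_zero]
  rintro ⟨a, b⟩ hab
  have hline : HasDerivAt (fun t : ℝ => F ((μ, 0) + t • (a, b))) 0 0 := by
    rw [← hab]
    exact (hF_an (μ, 0) trivial).differentiableAt.hasFDerivAt.hasLineDerivAt (a, b)
  have hcoord (n : ℕ) (hn : n < 2 * Fintype.card (Fin k)) :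
      ∑ ℓ, (lam ℓ * a ℓ * μ ℓ ^ n + lam ℓ * b ℓ / 2 * (n * μ ℓ ^ (n - 1))) = 0 := by
    rw [Fintype.card_fin] at hn
    have h₀ := hasDerivAt_pi.mp hline ⟨n, hn⟩
    have h₁ : HasDerivAt (fun t : ℝ => F ((μ, 0) + t • (a, b)) ⟨n, hn⟩)
        (∑ ℓ, lam ℓ * ((n + 1) * (a ℓ * μ ℓ ^ n + b ℓ / 2 * (n * μ ℓ ^ (n - 1))))) 0 := by
      rw [hF]
      refine HasDerivAt.fun_sum fun ℓ _ => HasDerivAt.const_mul _ ?_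
      have hu : HasDerivAt (fun t : ℝ => μ ℓ + t * a ℓ) (a ℓ) 0 := by
        simpa using ((hasDerivAt_id (0 : ℝ)).mul_const (a ℓ)).const_add (μ ℓ)
      have hw : HasDerivAt (fun t : ℝ => 0 + t * b ℓ) (b ℓ) 0 := by
        simpa using (hasDerivAt_id (0 : ℝ)).mul_const (b ℓ)
      simpa using hu.gaussMoment_succ hw (by simp) n
    have h₂ := h₁.unique h₀
    have hn₀ : (n + 1 : ℝ) ≠ 0 := by positivity
    refine (mul_eq_zero_iff_left hn₀).mp ?_
    rw [← show _ = (0 : ℝ) from h₂, Finset.mul_sum]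
    exact Finset.sum_congr rfl fun ℓ _ => by ring
  obtain ⟨ha, hb⟩ := Polynomial.hermite_functionals_independent hμ hcoord
  ext ℓ
  · simpa [hlam ℓ] using congrFun ha ℓ
  · simpa [hlam ℓ] using congrFun hb ℓ
end

section
/- Fix k ≥ 1, complex mixing weights λ_1, …, λ_k, each nonzero, and complex numbers m̄_1, …, m̄_{2k}. Let S ⊆ ℂ^{2k} be the set of tuples (μ_1, s_1, …, μ_k, s_k) satisfying the 2k moment equations Σ_{ℓ=1}^k λ_ℓ · M_i(μ_ℓ, s_ℓ) = m̄_i for i = 1, …, 2k. If S is finite, then the cardinality of S is at most (2k−1)!! · k!, where (2k−1)!! = 1·3·5⋯(2k−1) = ∏_{j=1}^{k} (2j−1). -/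
/-- In a Noetherian ring, `r` elements of the top of a chain of `r + 2` primes all lie in a prime
strictly below the top and above the bottom of the chain. -/
theorem PrimeSpectrum.exists_lt_last_of_ltSeries {R : Type*} [CommRing R] [IsNoetherianRing R]
    (r : ℕ) (p : LTSeries (PrimeSpectrum R)) (hp : p.length = r + 1) (t : Fin r → R)
    (ht : ∀ i, t i ∈ p.last.asIdeal) :
    ∃ q : PrimeSpectrum R, p.head ≤ q ∧ q < p.last ∧ ∀ i, t i ∈ q.asIdeal := by
  induction r generalizing p with
  | zero => exact ⟨p.head, le_rfl, p.strictMono (by simp [Fin.lt_def, hp]), fun i => i.elim0⟩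
  | succ r ih =>
    obtain ⟨p', h1, hlen, hhead, hlast⟩ := PrimeSpectrum.exist_ltSeries_mem_one_of_mem_last p (ht 0)
    have h0 : p'.length ≠ 0 := by omega
    obtain ⟨q, hq1, hq2, hq3⟩ := ih (p'.tail h0) (by simp; omega) (fun i => t i.succ)
      (fun i => by simpa [← hlast] using ht i.succ)
    rw [RelSeries.head_tail] at hq1
    rw [RelSeries.last_tail, ← hlast] at hq2
    refine ⟨q, hhead ▸ (p'.monotone (Fin.zero_le 1)).trans hq1, hq2, Fin.cases (hq1 h1) hq3⟩

/-- A system of parameters `t` at the top of a maximal-length chain of primes can be adapted to a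
chain, so that `t i` enters exactly at the `i`-th step. -/
theorem PrimeSpectrum.exists_adapted_chain {R : Type*} [CommRing R] [IsNoetherianRing R]
    (r : ℕ) (p : LTSeries (PrimeSpectrum R)) (hp : p.length = r) (t : Fin r → R)
    (ht : ∀ i, t i ∈ p.last.asIdeal)
    (hmin : ∀ q : PrimeSpectrum R, p.head ≤ q → q ≤ p.last → (∀ i, t i ∈ q.asIdeal) →
      q = p.last) :
    ∃ Q : Fin (r + 1) → PrimeSpectrum R, Q 0 = p.head ∧ Q (Fin.last r) = p.last ∧
      ∀ i : Fin r, Q i.castSucc ≤ Q i.succ ∧ t i ∈ (Q i.succ).asIdeal ∧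
        t i ∉ (Q i.castSucc).asIdeal := by
  induction r generalizing p with
  | zero =>
    refine ⟨fun _ => p.head, rfl, ?_, fun i => i.elim0⟩
    exact congrArg p (Fin.ext (by simp [hp]))
  | succ r ih =>
    have hnot : t 0 ∉ p.head.asIdeal := by
      intro h
      obtain ⟨q, hq1, hq2, hq3⟩ := PrimeSpectrum.exists_lt_last_of_ltSeries r p hp
        (fun i => t i.succ) (fun i => ht i.succ)
      exact hq2.ne (hmin q hq1 hq2.le (Fin.cases (hq1 h) hq3))
    obtain ⟨p', h1, hlen, hhead, hlast⟩ := PrimeSpectrum.exist_ltSeries_mem_one_of_mem_last p (ht 0)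
    have h0 : p'.length ≠ 0 := by omega
    have hle : p.head ≤ p' 1 := hhead ▸ p'.monotone (Fin.zero_le 1)
    obtain ⟨Q, hQ0, hQl, hQ⟩ := ih (p'.tail h0) (by simp; omega) (fun i => t i.succ)
      (fun i => by simpa [← hlast] using ht i.succ) (fun q hq1 hq2 hq3 => by
        rw [RelSeries.head_tail] at hq1
        rw [RelSeries.last_tail, ← hlast] at hq2 ⊢
        exact hmin q (hle.trans hq1) hq2 (Fin.cases (hq1 h1) hq3))
    rw [RelSeries.head_tail] at hQ0
    rw [RelSeries.last_tail, ← hlast] at hQl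
    refine ⟨Fin.cons p.head Q, rfl, by rw [← Fin.succ_last, Fin.cons_succ, hQl], ?_⟩
    refine Fin.cases ?_ fun i => ?_
    · simpa [hQ0, hnot, h1] using hle
    · simpa [← Fin.succ_castSucc] using hQ i

theorem Ideal.Quotient.mk_linearCombination {K R κ : Type*} [Field K] [CommRing R] [Algebra K R]
    (I : Ideal R) (b : κ → R) (y : κ →₀ K) :
    Ideal.Quotient.mk I (Finsupp.linearCombination K b y) =
      Finsupp.linearCombination K (fun i => Ideal.Quotient.mk I (b i)) y :=
  Finsupp.apply_linearCombination K (Ideal.Quotient.mkₐ K I).toLinearMap b y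

/-- If `t ∈ J` is regular modulo `I ≤ J`, multiplying a family independent modulo `J` by all powers
of `t` gives a family independent modulo `I`. -/
theorem LinearIndependent.pow_mul_quotient {K R κ : Type*} [Field K] [CommRing R] [Algebra K R]
    {I J : Ideal R} (hIJ : I ≤ J) {t : R} (ht : t ∈ J) (hreg : ∀ x, t * x ∈ I → x ∈ I)
    {b : κ → R} (hb : LinearIndependent K fun i => Ideal.Quotient.mk J (b i)) :
    LinearIndependent K fun x : ℕ × κ => Ideal.Quotient.mk I (t ^ x.1 * b x.2) := by
  have hb' (y : κ →₀ K) (hy : Finsupp.linearCombination K b y ∈ J) : y = 0 := by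
    refine linearIndependent_iff.1 hb y ?_
    rw [← Ideal.Quotient.mk_linearCombination, Ideal.Quotient.eq_zero_iff_mem.2 hy]
  have key (m : ℕ) : ∀ y : ℕ → κ →₀ K,
      ∑ a ∈ Finset.range m, t ^ a * Finsupp.linearCombination K b (y a) ∈ I →
      ∀ a < m, y a = 0 := by
    induction m with
    | zero => simp
    | succ m ih =>
      intro y hy
      rw [Finset.sum_range_succ'] at hy
      have hsum : ∑ a ∈ Finset.range m, t ^ (a + 1) * Finsupp.linearCombination K b (y (a + 1)) =
          t * ∑ a ∈ Finset.range m, t ^ a * Finsupp.linearCombination K b (y (a + 1)) := by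
        rw [Finset.mul_sum]
        exact Finset.sum_congr rfl fun a _ => by ring
      rw [hsum] at hy
      have h0 : y 0 = 0 := by
        refine hb' _ ?_
        simpa using (J.add_mem_iff_right (J.mul_mem_right _ ht)).1 (hIJ hy)
      rw [h0] at hy
      have := ih (fun a => y (a + 1)) (hreg _ (by simpa using hy))
      rintro (_ | a) ha
      · exact h0
      · exact this a (by omega)
  rw [linearIndependent_iff]
  intro c hc
  have hmem : Finsupp.linearCombination K (fun x : ℕ × κ => t ^ x.1 * b x.2) c ∈ I := by
    rw [← Ideal.Quotient.eq_zero_iff_mem, Ideal.Quotient.mk_linearCombination, hc]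
  have hcurry : Finsupp.linearCombination K (fun x : ℕ × κ => t ^ x.1 * b x.2) c =
      ∑ a ∈ Finset.range (c.curry.support.sup id + 1),
        t ^ a * Finsupp.linearCombination K b (c.curry a) := by
    rw [Finsupp.linearCombination_apply,
      ← Finsupp.sum_curry_index c (fun a i z => z • (t ^ a * b i))]
    rw [Finsupp.sum_of_support_subset (s := Finset.range (c.curry.support.sup id + 1))]
    · refine Finset.sum_congr rfl fun a _ => ?_
      rw [Finsupp.linearCombination_apply, Finsupp.sum, Finsupp.sum, Finset.mul_sum]
      exact Finset.sum_congr rfl fun i _ => (mul_smul_comm _ _ _).symm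
    · intro a ha
      exact Finset.mem_range.2 (Nat.lt_succ_of_le (Finset.le_sup (f := id) ha))
    · simp
  rw [hcurry] at hmem
  have hzero (a : ℕ) : c.curry a = 0 := by
    by_cases ha : a < c.curry.support.sup id + 1
    · exact key _ _ hmem a ha
    · by_contra hne
      exact ha (Nat.lt_succ_of_le
        (Finset.le_sup (f := id) (Finsupp.mem_support_iff.2 hne)))
  ext ⟨a, i⟩
  simpa using DFunLike.congr_fun (hzero a) i

/-- Iterated form of `LinearIndependent.pow_mul_quotient` along chains of primes adapted to `t`. -/
theorem LinearIndependent.prod_pow_mul_quotient {K R ι τ : Type*} [Field K] [CommRing R]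
    [Algebra K R] (n : ℕ) (t : Fin n → R) (Q : τ → Fin (n + 1) → PrimeSpectrum R)
    (hQ : ∀ j (i : Fin n), Q j i.castSucc ≤ Q j i.succ ∧ t i ∈ (Q j i.succ).asIdeal ∧
      t i ∉ (Q j i.castSucc).asIdeal)
    (b : ι → R)
    (hb : LinearIndependent K fun i =>
      Ideal.Quotient.mk (⨅ j, (Q j (Fin.last n)).asIdeal) (b i)) :
    LinearIndependent K fun x : (Fin n → ℕ) × ι =>
      Ideal.Quotient.mk (⨅ j, (Q j 0).asIdeal) ((∏ i, t i ^ x.1 i) * b x.2) := by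
  induction n with
  | zero =>
    have := hb.comp (fun x : (Fin 0 → ℕ) × ι => x.2)
      fun x y h => Prod.ext (Subsingleton.elim _ _) h
    simpa using! this
  | succ n ih =>
    have h1 := ih (fun i => t i.succ) (fun j i => Q j i.succ)
      (fun j i => by simpa using hQ j i.succ) hb
    have h2 := h1.pow_mul_quotient (I := ⨅ j, (Q j 0).asIdeal) (t := t 0)
      (iInf_mono fun j => (hQ j 0).1)
      ((Ideal.mem_iInf).2 fun j => (hQ j 0).2.1)
      (fun x hx => (Ideal.mem_iInf).2 fun j =>
        ((Q j 0).2.mem_or_mem ((Ideal.mem_iInf).1 hx j)).resolve_left (hQ j 0).2.2)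
    have h3 := h2.comp (fun x : (Fin (n + 1) → ℕ) × ι => (x.1 0, Fin.tail x.1, x.2)) (by
      rintro ⟨x, i⟩ ⟨y, j⟩ h
      simp only [Prod.mk.injEq] at h
      obtain ⟨h0, ht, rfl⟩ := h
      rw [← Fin.cons_self_tail x, ← Fin.cons_self_tail y, h0, ht])
    convert h3 using 2 with x
    simp [Fin.prod_univ_succ, Fin.tail, mul_assoc]

/-- The number of exponent vectors of `w`-weight at most `D`. -/
noncomputable def weightCount {ι : Type*} [Fintype ι] (w : ι → ℕ) (D : ℕ) : ℕ :=
  Nat.card {x : ι → ℕ // ∑ i, w i * x i ≤ D}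

section weightCount

variable {ι : Type*} [Fintype ι]

theorem finite_weight_le {w : ι → ℕ} (hw : ∀ i, 0 < w i) (D : ℕ) :
    Finite {x : ι → ℕ // ∑ i, w i * x i ≤ D} := by
  classical
  refine Set.Finite.subset (s := Set.Icc 0 (fun _ : ι => D)) (Set.finite_Icc _ _)
    (t := {x : ι → ℕ | ∑ i, w i * x i ≤ D}) fun x hx => ⟨fun _ => Nat.zero_le _, fun i => ?_⟩
  exact (Nat.le_mul_of_pos_left _ (hw i)).trans
    ((Finset.single_le_sum (f := fun i => w i * x i) (fun _ _ => Nat.zero_le _)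
      (Finset.mem_univ i)).trans hx)

theorem weightCount_mul_prod_le (w : ι → ℕ) (D : ℕ) :
    weightCount w D * ∏ i, w i ≤ weightCount (fun _ : ι => 1) (D + ∑ i, w i) := by
  have := finite_weight_le (fun _ : ι => one_pos) (D + ∑ i, w i)
  have hprod : ∏ i, w i = Nat.card (∀ i, Fin (w i)) := by simp [Nat.card_pi]
  rw [weightCount, weightCount, hprod, ← Nat.card_prod]
  refine Nat.card_le_card_of_injective (fun p => ⟨fun i => w i * p.1.1 i + p.2 i, ?_⟩) ?_
  · simp only [one_mul, Finset.sum_add_distrib]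
    exact add_le_add p.1.2 (Finset.sum_le_sum fun i _ => (p.2 i).2.le)
  · rintro ⟨⟨x, hx⟩, r⟩ ⟨⟨y, hy⟩, s⟩ h
    simp only [Subtype.mk.injEq] at h
    have h (i : ι) : w i * x i + r i = w i * y i + s i := congrFun h i
    have hr : r = s := by
      ext i
      have := congrArg (· % w i) (h i)
      simpa [Nat.mul_add_mod, Nat.mod_eq_of_lt] using this
    subst hr
    have hxy : x = y := by
      ext i
      exact Nat.eq_of_mul_eq_mul_left ((Nat.zero_le _).trans_lt (r i).2)
        (Nat.add_right_cancel (h i))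
    subst hxy
    rfl

theorem weightCount_one_le {d : ι → ℕ} (hd : ∀ i, 0 < d i) (D : ℕ) :
    weightCount (fun _ : ι => 1) D ≤ weightCount d D * ∏ i, d i := by
  have := finite_weight_le hd D
  have hprod : ∏ i, d i = Nat.card (∀ i, Fin (d i)) := by simp [Nat.card_pi]
  rw [weightCount, weightCount, hprod, ← Nat.card_prod]
  refine Nat.card_le_card_of_injective (fun x => (⟨fun i => x.1 i / d i, ?_⟩,
    fun i => ⟨x.1 i % d i, Nat.mod_lt _ (hd i)⟩)) ?_
  · refine le_trans (Finset.sum_le_sum fun i _ => ?_) x.2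
    rw [one_mul]
    exact Nat.mul_div_le _ _
  · rintro ⟨x, hx⟩ ⟨y, hy⟩ h
    simp only [Prod.mk.injEq, Subtype.mk.injEq, funext_iff, Fin.mk.injEq] at h
    refine Subtype.ext (funext fun i => ?_)
    change x i = y i
    rw [← Nat.div_add_mod (x i) (d i), ← Nat.div_add_mod (y i) (d i), h.1 i, h.2 i]

theorem weightCount_one_le_pow (D : ℕ) :
    weightCount (fun _ : ι => 1) D ≤ (D + 1) ^ Fintype.card ι := by
  have hpow : (D + 1) ^ Fintype.card ι = Nat.card (ι → Fin (D + 1)) := by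
    simp [Nat.card_fun]
  rw [weightCount, hpow]
  refine Nat.card_le_card_of_injective (fun x i => ⟨x.1 i, Nat.lt_succ_of_le ?_⟩) ?_
  · refine le_trans ?_ x.2
    simpa using Finset.single_le_sum (f := x.1) (fun _ _ => Nat.zero_le _) (Finset.mem_univ i)
  · intro x y h
    refine Subtype.ext (funext fun i => ?_)
    simpa using congrFun h i

end weightCount

theorem le_of_polynomial_growth {a b c e : ℕ} (hb : 0 < b) {f : ℕ → ℕ} (h0 : 0 < f 0)
    (hf : ∀ D, f D ≤ (D + 1) ^ e) (h : ∀ D, a * f D ≤ b * f (D + c)) : a ≤ b := by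
  by_contra! hab
  have hb' : (0 : ℝ) < b := by exact_mod_cast hb
  have hr : 1 < (a / b : ℝ) := by
    rw [one_lt_div hb']
    exact_mod_cast hab
  set r : ℝ := a / b with hr_def
  have hr0 : 0 < r := one_pos.trans hr
  have hexp (j : ℕ) : r ^ j ≤ f (j * c) := by
    induction j with
    | zero => simpa [Nat.one_le_iff_ne_zero] using h0.ne'
    | succ j ih =>
      have h1 : r * f (j * c) ≤ f ((j + 1) * c) := by
        have h2 : (a * f (j * c) : ℝ) ≤ b * f ((j + 1) * c) := by
          rw [add_one_mul]
          exact_mod_cast h (j * c)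
        rw [hr_def, div_mul_eq_mul_div, div_le_iff₀ hb', mul_comm (f _ : ℝ)]
        exact h2
      rw [pow_succ']
      exact (mul_le_mul_of_nonneg_left ih hr0.le).trans h1
  have hlim := (Filter.tendsto_add_atTop_iff_nat 1).2
    (tendsto_pow_const_div_const_pow_of_one_lt e hr)
  have hpos : 0 < 1 / (r * (c + 1) ^ e) := by positivity
  obtain ⟨j, hj⟩ := (hlim.eventually (gt_mem_nhds hpos)).exists
  have hbound : r ^ j ≤ ((c : ℝ) + 1) ^ e * ((j : ℝ) + 1) ^ e := by
    refine (hexp j).trans ?_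
    have h1 : (f (j * c) : ℝ) ≤ ((j : ℝ) * c + 1) ^ e := by exact_mod_cast hf (j * c)
    rw [← mul_pow]
    refine h1.trans (pow_le_pow_left₀ (by positivity) ?_ _)
    nlinarith [(Nat.cast_nonneg j : (0 : ℝ) ≤ j), (Nat.cast_nonneg c : (0 : ℝ) ≤ c)]
  rw [div_lt_div_iff₀ (by positivity) (by positivity), pow_succ] at hj
  push_cast at hj
  nlinarith [mul_le_mul_of_nonneg_right hbound hr0.le]

/-- If exponent vectors of `d`-weight at most `D`, taken `N` times, are never more numerous than
those of `w`-weight at most `D + c`, then `N ∏ w ≤ ∏ d`. -/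
theorem mul_prod_le_prod_of_weightCount_le {ι κ : Type*} [Fintype ι] [Fintype κ]
    (hcard : Fintype.card ι = Fintype.card κ) {d : ι → ℕ} (hd : ∀ i, 0 < d i) (w : κ → ℕ)
    {N c : ℕ} (h : ∀ D, N * weightCount d D ≤ weightCount w (D + c)) :
    N * ∏ j, w j ≤ ∏ i, d i := by
  let e : ι ≃ κ := Fintype.equivOfCardEq hcard
  have hcongr (D : ℕ) : weightCount (fun _ : κ => 1) D = weightCount (fun _ : ι => 1) D := by
    refine Nat.card_congr ((e.arrowCongr (Equiv.refl ℕ)).symm.subtypeEquiv fun x => ?_)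
    simp [← e.sum_comp]
  refine le_of_polynomial_growth (f := weightCount fun _ : ι => 1) (c := c + ∑ j, w j)
    (Finset.prod_pos fun i _ => hd i) ?_ weightCount_one_le_pow fun D => ?_
  · have := finite_weight_le (fun _ : ι => one_pos) 0
    exact Nat.card_pos_iff.2 ⟨⟨⟨fun _ => 0, by simp⟩⟩, this⟩
  · calc N * (∏ j, w j) * weightCount (fun _ : ι => 1) D
        ≤ N * (∏ j, w j) * (weightCount d D * ∏ i, d i) :=
          Nat.mul_le_mul_left _ (weightCount_one_le hd D)
      _ = N * weightCount d D * (∏ j, w j) * ∏ i, d i := by ring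
      _ ≤ weightCount w (D + c) * (∏ j, w j) * ∏ i, d i := by gcongr; exact h D
      _ ≤ weightCount (fun _ : κ => 1) (D + c + ∑ j, w j) * ∏ i, d i := by
          gcongr; exact weightCount_mul_prod_le w _
      _ = _ := by rw [hcongr, mul_comm, add_assoc]

section weightLE

open MvPolynomial

variable {K σ : Type*} [Field K]

/-- The polynomials all of whose monomials have `w`-weight at most `D`. -/
noncomputable def weightLE (K : Type*) [Field K] {σ : Type*} (w : σ → ℕ) (D : ℕ) :
    Submodule K (MvPolynomial σ K) :=
  restrictSupport K {β | Finsupp.weight w β ≤ D}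

theorem weightLE_mono (w : σ → ℕ) : Monotone (weightLE K w) := fun _ _ h =>
  restrictSupport_mono K fun _ hβ => le_trans hβ h

theorem exists_mem_weightLE (w : σ → ℕ) (p : MvPolynomial σ K) : ∃ D, p ∈ weightLE K w D :=
  ⟨p.support.sup (Finsupp.weight w), fun _ hβ => Finset.le_sup (f := Finsupp.weight w) hβ⟩

theorem mul_mem_weightLE {w : σ → ℕ} {a b : ℕ} {p q : MvPolynomial σ K}
    (hp : p ∈ weightLE K w a) (hq : q ∈ weightLE K w b) : p * q ∈ weightLE K w (a + b) := by
  classical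
  intro β hβ
  obtain ⟨x, hx, y, hy, rfl⟩ := Finset.mem_add.1 (support_mul p q hβ)
  simpa using! add_le_add (hp hx) (hq hy)

theorem C_mem_weightLE (w : σ → ℕ) (D : ℕ) (z : K) : C z ∈ weightLE K w D := by
  simp [weightLE, ← monomial_zero']

theorem X_mem_weightLE (w : σ → ℕ) (a : σ) : X a ∈ weightLE K w (w a) := by
  simp [weightLE, X, Finsupp.weight_single]

theorem pow_mem_weightLE {w : σ → ℕ} {a : ℕ} {p : MvPolynomial σ K}
    (hp : p ∈ weightLE K w a) (m : ℕ) : p ^ m ∈ weightLE K w (a * m) := by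
  induction m with
  | zero => simpa using C_mem_weightLE w 0 (1 : K)
  | succ m ih => exact mul_mem_weightLE ih hp

theorem prod_mem_weightLE {ι : Type*} {w : σ → ℕ} (s : Finset ι) {a : ι → ℕ}
    {p : ι → MvPolynomial σ K} (hp : ∀ i ∈ s, p i ∈ weightLE K w (a i)) :
    ∏ i ∈ s, p i ∈ weightLE K w (∑ i ∈ s, a i) := by
  classical
  induction s using Finset.induction_on with
  | empty => simpa using C_mem_weightLE w 0 (1 : K)
  | insert i s hi ih =>
    rw [Finset.prod_insert hi, Finset.sum_insert hi]
    exact mul_mem_weightLE (hp i (by simp)) (ih fun j hj => hp j (by simp [hj]))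

variable [Fintype σ] {w : σ → ℕ}

theorem finite_weightLE (hw : ∀ a, 0 < w a) (D : ℕ) : Module.Finite K (weightLE K w D) := by
  have := (Finsupp.finite_of_nat_weight_le w (fun a => (hw a).ne') D).to_subtype
  exact Module.Finite.of_basis (basisRestrictSupport K {β | Finsupp.weight w β ≤ D})

theorem finrank_weightLE (w : σ → ℕ) (D : ℕ) :
    Module.finrank K (weightLE K w D) = weightCount w D := by
  rw [weightLE, Module.finrank_eq_nat_card_basis
    (basisRestrictSupport K {β : σ →₀ ℕ | Finsupp.weight w β ≤ D})]
  refine Nat.card_congr (Finsupp.equivFunOnFinite.subtypeEquiv fun β => ?_)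
  simp [Finsupp.weight_apply, Finsupp.sum_fintype, mul_comm]

end weightLE

section zeros

open MvPolynomial

variable {K σ : Type*} [Field K]

/-- Through the maximal ideal of a point there is a chain of primes of length the number of
variables, starting at `⊥`. -/
theorem exists_ltSeries_last_eq_vanishingIdeal {n : ℕ} (e : σ ≃ Fin n) (x : σ → K) :
    ∃ p : LTSeries (PrimeSpectrum (MvPolynomial σ K)), p.length = n ∧
      p.last.asIdeal = vanishingIdeal K {x} := by
  let φ (i : Fin (n + 1)) : MvPolynomial σ K →ₐ[K] MvPolynomial σ K :=
    aeval fun a => if (e a).castSucc < i then C (x a) else X a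
  have hφ (i j : Fin (n + 1)) (h : i ≤ j) (f : MvPolynomial σ K) : φ j (φ i f) = φ j f := by
    suffices (φ j).comp (φ i) = φ j from DFunLike.congr_fun this f
    refine MvPolynomial.algHom_ext fun a => ?_
    by_cases ha : (e a).castSucc < i
    · simp [φ, ha, ha.trans_le h, ← algebraMap_eq]
    · simp [φ, ha]
  let q (i : Fin (n + 1)) : PrimeSpectrum (MvPolynomial σ K) :=
    ⟨RingHom.ker (φ i), RingHom.ker_isPrime _⟩
  refine ⟨⟨n, q, fun i => ?_⟩, rfl, ?_⟩
  · refine lt_of_le_of_ne (show (q i.castSucc).asIdeal ≤ (q i.succ).asIdeal from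
      fun f hf => ?_) fun h => ?_
    · change φ _ f = 0
      rw [← hφ _ _ i.castSucc_lt_succ.le, show φ i.castSucc f = 0 from hf, map_zero]
    · have hmem : X (e.symm i) - C (x (e.symm i)) ∈ (q i.succ).asIdeal := by
        change φ _ _ = 0
        simp [φ, ← algebraMap_eq]
      rw [← h] at hmem
      have h0 : φ i.castSucc (X (e.symm i) - C (x (e.symm i))) = 0 := hmem
      simp only [φ, ← algebraMap_eq, map_sub, aeval_X, Equiv.apply_symm_apply, lt_self_iff_false,
        if_false, AlgHom.commutes] at h0
      have := congrArg (eval fun _ => x (e.symm i) + 1) h0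
      simp [algebraMap_eq] at this
  · ext f
    change φ (Fin.last n) f = 0 ↔ _
    rw [mem_vanishingIdeal_singleton_iff]
    have : φ (Fin.last n) f = C (aeval x f) := by
      suffices φ (Fin.last n) = (Algebra.ofId K _).comp (aeval x) from DFunLike.congr_fun this f
      refine MvPolynomial.algHom_ext fun a => ?_
      simp [φ, Fin.castSucc_lt_last, Algebra.ofId_apply, algebraMap_eq]
    rw [this, C_eq_zero]

/-- A finite set of points can be separated by polynomials. -/
theorem exists_separating_polynomials {S : Set (σ → K)} (hS : S.Finite) :
    ∃ g : S → MvPolynomial σ K, (∀ x : S, aeval x.1 (g x) ≠ 0) ∧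
      ∀ x y : S, x ≠ y → aeval y.1 (g x) = 0 := by
  classical
  have := hS.fintype
  have hne (x y : S) (h : x ≠ y) : ∃ a, x.1 a ≠ y.1 a := by
    by_contra! hxy
    exact h (Subtype.ext (funext hxy))
  choose a ha using hne
  let g (x : S) : MvPolynomial σ K :=
    ∏ y, if h : x ≠ y then X (a x y h) - C (y.1 (a x y h)) else 1
  refine ⟨g, fun x => ?_, fun x y h => ?_⟩
  · rw [map_prod, Finset.prod_ne_zero_iff]
    intro y _
    split_ifs with h
    · simpa [sub_eq_zero] using ha x y h
    · simp
  · rw [map_prod]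
    refine Finset.prod_eq_zero (Finset.mem_univ y) ?_
    simp [h]

variable [IsAlgClosed K] [Finite σ]

/-- A prime ideal whose zeros are finite in number, one of them `x`, is the ideal of `x`. -/
theorem eq_vanishingIdeal_of_finite_zeroLocus {P : Ideal (MvPolynomial σ K)} [P.IsPrime]
    (hfin : (zeroLocus K P).Finite) {x : σ → K} (hx : P ≤ vanishingIdeal K {x}) :
    P = vanishingIdeal K {x} := by
  refine le_antisymm hx fun f hf => ?_
  obtain ⟨g, hg, hg'⟩ := exists_separating_polynomials hfin
  have hxP : x ∈ zeroLocus K P := fun p hp => hx hp x rfl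
  have hmul : f * g ⟨x, hxP⟩ ∈ P := by
    refine (IsPrime.vanishingIdeal_zeroLocus (K := K) P).le fun y hy => ?_
    rw [map_mul]
    by_cases hxy : x = y
    · rw [← hxy, hf x rfl, zero_mul]
    · rw [hg' ⟨x, hxP⟩ ⟨y, hy⟩ (by simpa using hxy), mul_zero]
  exact (Ideal.IsPrime.mem_or_mem ‹_› hmul).resolve_right fun h => hg ⟨x, hxP⟩ (hx h x rfl)

/-- Products of powers of `n` polynomials in `n` variables with finite zero set `S`, multiplied by
suitable `#S` polynomials, are linearly independent. -/
theorem exists_linearIndependent_prod_pow_mul {n : ℕ} (e : σ ≃ Fin n)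
    (t : Fin n → MvPolynomial σ K) {S : Set (σ → K)} (hS : S = {x | ∀ i, aeval x (t i) = 0})
    (hfin : S.Finite) :
    ∃ g : S → MvPolynomial σ K,
      LinearIndependent K fun x : (Fin n → ℕ) × S => (∏ i, t i ^ x.1 i) * g x.2 := by
  have hchain (x : S) : ∃ Q : Fin (n + 1) → PrimeSpectrum (MvPolynomial σ K),
      (Q (Fin.last n)).asIdeal = vanishingIdeal K {x.1} ∧
      ∀ i : Fin n, Q i.castSucc ≤ Q i.succ ∧ t i ∈ (Q i.succ).asIdeal ∧
        t i ∉ (Q i.castSucc).asIdeal := by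
    obtain ⟨p, hlen, hlast⟩ := exists_ltSeries_last_eq_vanishingIdeal e x.1
    obtain ⟨Q, -, hQl, hQ⟩ := PrimeSpectrum.exists_adapted_chain n p hlen t
      (fun i => by
        rw [hlast, mem_vanishingIdeal_singleton_iff]
        exact hS.subset x.2 i)
      (fun q _ hq hqt => by
        refine PrimeSpectrum.ext ?_
        rw [hlast]
        refine eq_vanishingIdeal_of_finite_zeroLocus (hfin.subset fun y hy => ?_) (hlast ▸ hq)
        rw [hS]
        exact fun i => hy _ (hqt i))
    exact ⟨Q, by rw [hQl, hlast], hQ⟩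
  choose Q hQl hQ using hchain
  obtain ⟨g, hg, hg'⟩ := exists_separating_polynomials hfin
  refine ⟨g, LinearIndependent.of_comp (Ideal.Quotient.mkₐ K _).toLinearMap
    (LinearIndependent.prod_pow_mul_quotient n t Q hQ g ?_)⟩
  rw [linearIndependent_iff]
  intro c hc
  rw [← Ideal.Quotient.mk_linearCombination, Ideal.Quotient.eq_zero_iff_mem, Ideal.mem_iInf] at hc
  ext x
  have := hc x
  rw [hQl, mem_vanishingIdeal_singleton_iff, Finsupp.linearCombination_apply, Finsupp.sum,
    map_sum, Finset.sum_eq_single x (fun y _ h => by simp [hg' y x h])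
      (fun h => by simp [Finsupp.notMem_support_iff.1 h])] at this
  rw [map_smul, smul_eq_mul] at this
  exact (mul_eq_zero.1 this).resolve_right (hg x)

/-- Weighted Bézout bound: if `n` polynomials of weighted degrees at most `d i` in `n` variables
of weights `w a` have finitely many common zeros, their number is at most `∏ d / ∏ w`. -/
theorem natCard_mul_prod_weight_le [Fintype σ] {n : ℕ} (e : σ ≃ Fin n) {w : σ → ℕ}
    (hw : ∀ a, 0 < w a) {d : Fin n → ℕ} (hd : ∀ i, 0 < d i) {t : Fin n → MvPolynomial σ K}
    (ht : ∀ i, t i ∈ weightLE K w (d i)) {S : Set (σ → K)}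
    (hS : S = {x | ∀ i, aeval x (t i) = 0}) (hfin : S.Finite) :
    Nat.card S * ∏ a, w a ≤ ∏ i, d i := by
  obtain ⟨g, hg⟩ := exists_linearIndependent_prod_pow_mul e t hS hfin
  have := hfin.fintype
  choose c hc using fun x => exists_mem_weightLE w (g x)
  have hgc (x : S) : g x ∈ weightLE K w (∑ y, c y) :=
    weightLE_mono w (Finset.single_le_sum (fun _ _ => Nat.zero_le _) (Finset.mem_univ x)) (hc x)
  refine mul_prod_le_prod_of_weightCount_le (Fintype.card_congr e.symm) hd w (c := ∑ y, c y)
    fun D => ?_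
  have := finite_weight_le hd D
  have := Fintype.ofFinite {α : Fin n → ℕ // ∑ i, d i * α i ≤ D}
  have := finite_weightLE (K := K) hw (D + ∑ y, c y)
  have hmem (x : {α : Fin n → ℕ // ∑ i, d i * α i ≤ D} × S) :
      (∏ i, t i ^ x.1.1 i) * g x.2 ∈ weightLE K w (D + ∑ y, c y) :=
    mul_mem_weightLE (weightLE_mono w x.1.2
      (prod_mem_weightLE _ fun i _ => pow_mem_weightLE (ht i) _)) (hgc x.2)
  have hli : LinearIndependent K fun x : {α : Fin n → ℕ // ∑ i, d i * α i ≤ D} × S =>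
      (⟨_, hmem x⟩ : weightLE K w (D + ∑ y, c y)) :=
    LinearIndependent.of_comp (weightLE K w (D + ∑ y, c y)).subtype
      (hg.comp (Prod.map Subtype.val id) (Subtype.val_injective.prodMap Function.injective_id))
  rw [← finrank_weightLE (K := K) w, weightCount, mul_comm, ← Nat.card_prod,
    Nat.card_eq_fintype_card]
  exact hli.fintype_card_le_finrank

end zeros

section gaussMoment

open MvPolynomial

theorem map_gaussMoment {α β : Type*} [CommRing α] [CommRing β] (f : α →+* β) (i : ℕ) (μ v : α) :
    f (gaussMoment i μ v) = gaussMoment i (f μ) (f v) := by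
  induction i using Nat.twoStepInduction with
  | zero => simp [gaussMoment]
  | one => simp [gaussMoment]
  | more i h0 h1 => simp [gaussMoment, h0, h1]

theorem gaussMoment_mem_weightLE {K σ : Type*} [Field K] {w : σ → ℕ} {μ v : MvPolynomial σ K}
    (hμ : μ ∈ weightLE K w 1) (hv : v ∈ weightLE K w 2) (i : ℕ) :
    gaussMoment i μ v ∈ weightLE K w i := by
  induction i using Nat.twoStepInduction with
  | zero => simpa [gaussMoment] using C_mem_weightLE w 0 (1 : K)
  | one => exact hμ
  | more i h0 h1 =>
    refine Submodule.add_mem _ ?_ ?_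
    · exact weightLE_mono w (by omega) (mul_mem_weightLE hμ h1)
    · have hc : ((i : MvPolynomial σ K) + 1) ∈ weightLE K w 0 := by
        simpa using C_mem_weightLE w 0 ((i : K) + 1)
      exact weightLE_mono w (by omega) (mul_mem_weightLE (mul_mem_weightLE hc hv) h0)

end gaussMoment

theorem factorial_two_mul (k : ℕ) :
    (2 * k).factorial = (∏ j ∈ Finset.range k, (2 * j + 1)) * k.factorial * 2 ^ k := by
  induction k with
  | zero => rfl
  | succ k ih =>
    rw [mul_add_one, Nat.factorial_succ, Nat.factorial_succ, ih, Finset.prod_range_succ,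
      Nat.factorial_succ]
    ring

/-- If the solution set of the λ-weighted Gaussian `k`-mixture moment system given by the
first `2k` moments is finite, then it has at most `(2k-1)!! * k!` elements. -/
theorem lambdaWeighted_solution_bound (k : ℕ) (hk : 1 ≤ k)
    (lam : Fin k → ℂ) (hlam : ∀ ℓ, lam ℓ ≠ 0) (m : Fin (2 * k) → ℂ)
    (S : Set ((Fin k → ℂ) × (Fin k → ℂ)))
    (hS : S = {x | ∀ i : Fin (2 * k),
      ∑ ℓ, lam ℓ * gaussMoment (i.1 + 1) (x.1 ℓ) (x.2 ℓ) = m i})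
    (hfin : S.Finite) :
    Nat.card S ≤ (∏ j ∈ Finset.range k, (2 * j + 1)) * k.factorial := by
  classical
  let φ : (Fin k → ℂ) × (Fin k → ℂ) ≃ (Fin k ⊕ Fin k → ℂ) :=
    (Equiv.sumArrowEquivProdArrow (Fin k) (Fin k) ℂ).symm
  let e : Fin k ⊕ Fin k ≃ Fin (2 * k) := Fintype.equivFinOfCardEq (by simp [two_mul])
  let t (i : Fin (2 * k)) : MvPolynomial (Fin k ⊕ Fin k) ℂ :=
    ∑ ℓ, MvPolynomial.C (lam ℓ) * gaussMoment (i.1 + 1) (MvPolynomial.X (Sum.inl ℓ))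
      (MvPolynomial.X (Sum.inr ℓ)) - MvPolynomial.C (m i)
  let w : Fin k ⊕ Fin k → ℕ := Sum.elim (fun _ => 1) fun _ => 2
  have hw : ∀ a, 0 < w a := by rintro (_ | _) <;> simp [w]
  have ht (i : Fin (2 * k)) : t i ∈ weightLE ℂ w (i.1 + 1) := by
    refine Submodule.sub_mem _ (Submodule.sum_mem _ fun ℓ _ => ?_) (C_mem_weightLE _ _ _)
    rw [← MvPolynomial.smul_eq_C_mul]
    exact Submodule.smul_mem _ _ (gaussMoment_mem_weightLE
      (X_mem_weightLE w (Sum.inl ℓ)) (X_mem_weightLE w (Sum.inr ℓ)) _)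
  have heval (x : (Fin k → ℂ) × (Fin k → ℂ)) (i : Fin (2 * k)) :
      MvPolynomial.eval (φ x) (t i) =
        ∑ ℓ, lam ℓ * gaussMoment (i.1 + 1) (x.1 ℓ) (x.2 ℓ) - m i := by
    have hmom (ℓ : Fin k) : MvPolynomial.eval (φ x) (gaussMoment (i.1 + 1)
        (MvPolynomial.X (Sum.inl ℓ)) (MvPolynomial.X (Sum.inr ℓ))) =
        gaussMoment (i.1 + 1) (x.1 ℓ) (x.2 ℓ) := by
      rw [map_gaussMoment, MvPolynomial.eval_X, MvPolynomial.eval_X]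
      rfl
    simp [t, hmom]
  have hcard := natCard_mul_prod_weight_le e hw (fun i : Fin (2 * k) => i.1.succ_pos) ht
    (S := φ '' S) (by
      ext y
      obtain ⟨x, rfl⟩ := φ.surjective y
      simp [hS, heval, sub_eq_zero]) (hfin.image φ)
  have hfact : ∏ i : Fin (2 * k), (i.1 + 1) = (2 * k).factorial := by
    rw [Fin.prod_univ_eq_prod_range (fun i => i + 1), Finset.prod_range_add_one_eq_factorial]
  have hprod : ∏ a, w a = 2 ^ k := by simp [w]
  rw [Nat.card_image_of_injective φ.injective, hprod] at hcard
  refine le_of_mul_le_mul_right ?_ (pow_pos two_pos k)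
  rw [← factorial_two_mul, ← hfact]
  exact hcard
end

section
/- Fix k ≥ 1, complex numbers λ_1, …, λ_k, complex numbers s_1, …, s_k (the known variances), and complex numbers m̄_1, …, m̄_k. Let S ⊆ ℂ^k be the set of tuples (μ_1, …, μ_k) satisfying the k moment equations Σ_{ℓ=1}^k λ_ℓ · M_i(μ_ℓ, s_ℓ) = m̄_i for i = 1, …, k. If S is finite, then the cardinality of S is at most k!. -/
open MvPolynomial in
theorem MvPolynomial.eq_sum_smul_monomial_of_totalDegree_le {σ R : Type*} [CommSemiring R] {D : ℕ}
    [Fintype {a : σ →₀ ℕ // a.degree ≤ D}] (p : MvPolynomial σ R) (hp : p.totalDegree ≤ D) :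
    p = ∑ b : {a : σ →₀ ℕ // a.degree ≤ D}, coeff b.1 p • monomial b.1 1 := by
  classical
  ext m
  simp only [coeff_sum, coeff_smul, coeff_monomial, smul_eq_mul, mul_ite, mul_one, mul_zero]
  by_cases hm : m.degree ≤ D
  · rw [Finset.sum_eq_single ⟨m, hm⟩]
    · simp
    · intro b _ hb
      rw [if_neg fun h => hb (Subtype.ext h)]
    · simp
  · rw [Finset.sum_eq_zero fun b _ => if_neg fun h : b.1 = m => hm (h ▸ b.2)]
    by_contra h
    exact hm ((le_totalDegree (mem_support_iff.2 h)).trans hp)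

namespace BezoutBound

open Polynomial (C)
open MvPolynomial hiding C

variable {n : ℕ} {K : Type*} [Field K]

/-- The system `ε xᵢ ^ dᵢ - fᵢ` over `K[ε]`, a deformation of the system `f`. -/
noncomputable def deform (d : Fin n → ℕ) (f : Fin n → MvPolynomial (Fin n) K) (i : Fin n) :
    MvPolynomial (Fin n) (Polynomial K) :=
  (Polynomial.X : Polynomial K) • MvPolynomial.X i ^ d i - MvPolynomial.map C (f i)

/-- The monomials whose exponent in `xᵢ` is less than `dᵢ` for all `i`. -/
noncomputable def reducedMonomial (R : Type*) [CommSemiring R] (d : Fin n → ℕ)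
    (a : ∀ i, Fin (d i)) : MvPolynomial (Fin n) R :=
  monomial (Finsupp.equivFunOnFinite.symm fun i => (a i : ℕ)) 1

/-- Over `K(ε)`, the reduced monomials span the polynomial ring modulo the deformed system. -/
theorem exists_smul_mem_span_reducedMonomial (d : Fin n → ℕ)
    (f : Fin n → MvPolynomial (Fin n) K) (hf : ∀ i, (f i).totalDegree ≤ d i)
    (v : MvPolynomial (Fin n) (Polynomial K)) :
    ∃ r : Polynomial K, r ≠ 0 ∧
      r • v ∈ Submodule.span (Polynomial K) (Set.range (reducedMonomial (Polynomial K) d)) ⊔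
        (Ideal.span (Set.range (deform d f))).restrictScalars (Polynomial K) := by
  classical
  set W := Submodule.span (Polynomial K) (Set.range (reducedMonomial (Polynomial K) d)) ⊔
        (Ideal.span (Set.range (deform d f))).restrictScalars (Polynomial K)
  set D := v.totalDegree
  have : Finite {a : Fin n →₀ ℕ // a.degree ≤ D} := Finsupp.finite_of_degree_le D
  have := Fintype.ofFinite {a : Fin n →₀ ℕ // a.degree ≤ D}
  let mon (a : {a : Fin n →₀ ℕ // a.degree ≤ D}) : MvPolynomial (Fin n) (Polynomial K) :=
    monomial a.1 1
  have key : ∀ a, ∃ c : {a : Fin n →₀ ℕ // a.degree ≤ D} → K,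
      (Polynomial.X : Polynomial K) • mon a - ∑ b, C (c b) • mon b ∈ W := by
    intro a
    by_cases ha : ∀ i, a.1 i < d i
    · refine ⟨0, ?_⟩
      have : mon a ∈ W := by
        refine Submodule.mem_sup_left (Submodule.subset_span ⟨fun i => ⟨a.1 i, ha i⟩, ?_⟩)
        simp only [reducedMonomial, mon]
        exact congrArg (fun e => monomial e 1) (Finsupp.ext fun i => rfl)
      simpa using W.smul_mem _ this
    · push Not at ha
      obtain ⟨i, hi⟩ := ha
      have hle : Finsupp.single i (d i) ≤ a.1 := by simpa using hi
      set e := a.1 - Finsupp.single i (d i)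
      have hea : e + Finsupp.single i (d i) = a.1 := tsub_add_cancel_of_le hle
      have hdeg : e.degree + d i = a.1.degree := by rw [← hea]; simp
      have hg : (monomial e (1 : K) * f i).totalDegree ≤ D := by
        have h1 := totalDegree_mul (monomial e (1 : K)) (f i)
        have h2 : (monomial e (1 : K)).totalDegree ≤ e.degree := totalDegree_monomial_le e 1
        have := hf i
        have := a.2
        omega
      refine ⟨fun b => coeff b.1 (monomial e 1 * f i), Submodule.mem_sup_right ?_⟩
      have h3 : ∑ b, C (coeff b.1 (monomial e 1 * f i)) • mon b
          = MvPolynomial.map C (monomial e 1 * f i) := by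
        conv_rhs => rw [eq_sum_smul_monomial_of_totalDegree_le _ hg]
        simp [mon, MvPolynomial.smul_eq_C_mul]
      have h4 : (Polynomial.X : Polynomial K) • mon a - MvPolynomial.map C (monomial e 1 * f i)
          = monomial e 1 * deform d f i := by
        simp only [deform, mul_sub, mon, map_mul, map_monomial, map_one, mul_smul_comm,
          X_pow_eq_monomial, monomial_mul, hea, mul_one]
      rw [h3, h4]
      exact Ideal.mul_mem_left _ _ (Ideal.subset_span ⟨i, rfl⟩)
  choose c hc using key
  let N : Matrix _ _ K := Matrix.of c
  have hT (a) : ∑ b, N.charmatrix a b • mon b ∈ W := by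
    convert hc a using 1
    simp [Matrix.charmatrix_apply, Matrix.diagonal_apply, sub_smul, Finset.sum_sub_distrib, N,
      ite_smul]
  have hdet (b) : N.charmatrix.det • mon b ∈ W := by
    have : N.charmatrix.det • mon b
        = ∑ a, N.charmatrix.adjugate b a • ∑ b', N.charmatrix a b' • mon b' := by
      simp only [Finset.smul_sum, smul_smul]
      rw [Finset.sum_comm]
      simp only [← Finset.sum_smul, ← Matrix.mul_apply, Matrix.adjugate_mul]
      simp [Matrix.one_apply, ite_smul]
    rw [this]
    exact W.sum_mem fun a _ => W.smul_mem _ (hT a)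
  refine ⟨N.charmatrix.det, N.charpoly_monic.ne_zero, ?_⟩
  rw [eq_sum_smul_monomial_of_totalDegree_le v le_rfl, Finset.smul_sum]
  refine W.sum_mem fun b _ => ?_
  rw [smul_comm]
  exact W.smul_mem _ (hdet b)

/-- Every polynomial is algebraic of degree at most `∏ dᵢ` over `K(ε)` modulo the
deformed system. -/
theorem exists_aeval_mem_span_deform (d : Fin n → ℕ)
    (f : Fin n → MvPolynomial (Fin n) K) (hf : ∀ i, (f i).totalDegree ≤ d i)
    (u : MvPolynomial (Fin n) (Polynomial K)) :
    ∃ c : Polynomial (Polynomial K), c ≠ 0 ∧ c.natDegree ≤ ∏ i, d i ∧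
      Polynomial.aeval u c ∈ Ideal.span (Set.range (deform d f)) := by
  classical
  have key : ∀ j : Fin ((∏ i, d i) + 1), ∃ (r : Polynomial K)
      (g : (∀ i, Fin (d i)) → Polynomial K), r ≠ 0 ∧
      r • u ^ (j : ℕ) - ∑ a, g a • reducedMonomial _ d a ∈ Ideal.span (Set.range (deform d f)) := by
    intro j
    obtain ⟨r, hr, h⟩ := exists_smul_mem_span_reducedMonomial d f hf (u ^ (j : ℕ))
    obtain ⟨y, hy, z, hz, hyz⟩ := Submodule.mem_sup.1 h
    obtain ⟨g, rfl⟩ := (Submodule.mem_span_range_iff_exists_fun _).1 hy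
    exact ⟨r, g, hr, by simpa [← hyz] using hz⟩
  choose r g hr hg using key
  have hdep : ¬ LinearIndependent (Polynomial K) g := fun h => by
    have := h.fintype_card_le_finrank
    simp at this
  obtain ⟨q, hq, j, hj⟩ := Fintype.not_linearIndependent_iff.1 hdep
  refine ⟨∑ j : Fin _, Polynomial.monomial (j : ℕ) (q j * r j), fun h => ?_, ?_, ?_⟩
  · have := congrArg (fun p => Polynomial.coeff p j) h
    simp only [Polynomial.finsetSum_coeff, Polynomial.coeff_monomial, Polynomial.coeff_zero,
      Fin.val_inj] at this
    simp [hj, hr] at this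
  · exact Polynomial.natDegree_sum_le_of_forall_le _ _ fun j _ =>
      (Polynomial.natDegree_monomial_le _).trans (Nat.lt_succ_iff.1 j.2)
  · have h1 : Polynomial.aeval u (∑ j : Fin _, Polynomial.monomial (j : ℕ) (q j * r j))
        = ∑ j, q j • (r j • u ^ (j : ℕ) - ∑ a, g j a • reducedMonomial _ d a) := by
      have h2 : ∑ j, q j • ∑ a, g j a • reducedMonomial (Polynomial K) d a = 0 := by
        simp only [Finset.smul_sum, smul_smul]
        rw [Finset.sum_comm]
        refine Finset.sum_eq_zero fun a _ => ?_
        have := congrFun hq a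
        simp only [Finset.sum_apply, Pi.smul_apply, smul_eq_mul, Pi.zero_apply] at this
        rw [← Finset.sum_smul, this, zero_smul]
      simp only [smul_sub, Finset.sum_sub_distrib, h2, sub_zero, smul_smul]
      simp [Polynomial.aeval_monomial, Algebra.smul_def]
    rw [h1]
    exact Ideal.sum_mem _ fun j _ => Submodule.smul_of_tower_mem _ _ (hg j)

/-- Evaluation at the point `ε = 0`, `x = p`. -/
noncomputable def evalZeroAt (p : Fin n → K) : MvPolynomial (Fin n) (Polynomial K) →+* K :=
  eval₂Hom Polynomial.constantCoeff p

theorem evalZeroAt_map (p : Fin n → K) (g : MvPolynomial (Fin n) K) :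
    evalZeroAt p (MvPolynomial.map C g) = eval p g := by
  simp only [evalZeroAt, coe_eval₂Hom, eval₂_map]
  have : (Polynomial.constantCoeff : Polynomial K →+* K).comp C = RingHom.id K := by ext; simp
  rw [this]
  rfl

theorem evalZeroAt_deform (d : Fin n → ℕ) (f : Fin n → MvPolynomial (Fin n) K) (p : Fin n → K)
    (i : Fin n) : evalZeroAt p (deform d f i) = - eval p (f i) := by
  rw [deform, map_sub, evalZeroAt_map, MvPolynomial.smul_eq_C_mul]
  simp [evalZeroAt]

/-- The substitution of the constants `p i` for the first `j` variables. -/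
noncomputable def substFirst (p : Fin n → K) (j : ℕ) :
    MvPolynomial (Fin n) (Polynomial K) →ₐ[Polynomial K] MvPolynomial (Fin n) (Polynomial K) :=
  aeval fun i => if i.1 < j then MvPolynomial.C (C (p i)) else MvPolynomial.X i

theorem substFirst_substFirst (p : Fin n → K) {j l : ℕ} (h : j ≤ l)
    (g : MvPolynomial (Fin n) (Polynomial K)) :
    substFirst p l (substFirst p j g) = substFirst p l g := by
  have : (substFirst p l).comp (substFirst p j) = substFirst p l := by
    ext1 i
    simp only [substFirst, AlgHom.comp_apply, aeval_X]
    split_ifs <;> first | omega | simp [*]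
  exact DFunLike.congr_fun this g

theorem evalZeroAt_substFirst (p : Fin n → K) (j : ℕ) (g : MvPolynomial (Fin n) (Polynomial K)) :
    evalZeroAt p (substFirst p j g) = evalZeroAt p g := by
  have : (evalZeroAt p).comp (substFirst p j : _ →+* _) = evalZeroAt p := by
    refine MvPolynomial.ringHom_ext (fun r => ?_) fun i => ?_
    · simp [substFirst, evalZeroAt]
    · simp only [substFirst, RingHom.comp_apply, RingHom.coe_coe, aeval_X]
      split_ifs <;> simp [evalZeroAt]
  exact DFunLike.congr_fun this g

theorem le_height_ker_substFirst (p : Fin n → K) (j : ℕ) (hj : j ≤ n) :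
    (j : ℕ∞) ≤ (RingHom.ker (substFirst p j)).height := by
  induction j with
  | zero => simp
  | succ j ih =>
    have := RingHom.ker_isPrime (substFirst p j)
    have := RingHom.ker_isPrime (substFirst p (j + 1))
    have hlt : RingHom.ker (substFirst p j) < RingHom.ker (substFirst p (j + 1)) := by
      refine lt_of_le_of_ne (fun g hg => ?_) fun h => ?_
      · rw [RingHom.mem_ker] at hg ⊢
        rw [← substFirst_substFirst p j.le_succ, hg, map_zero]
      · have hmem : MvPolynomial.X ⟨j, hj⟩ - MvPolynomial.C (C (p ⟨j, hj⟩)) ∈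
            RingHom.ker (substFirst p (j + 1)) := by
          simp [substFirst, RingHom.mem_ker, algebraMap_eq]
        rw [← h, RingHom.mem_ker] at hmem
        have h2 := congrArg (coeff (Finsupp.single ⟨j, hj⟩ 1)) hmem
        simp [substFirst, algebraMap_eq, coeff_C, eq_comm (a := (0 : Fin n →₀ ℕ))] at h2
    push_cast
    exact (add_le_add_left (ih (by omega)) 1).trans (Ideal.height_add_one_le_of_lt_of_isPrime hlt)

theorem lt_height_ker_evalZeroAt (p : Fin n → K) :
    (n : ℕ∞) < (RingHom.ker (evalZeroAt p)).height := by
  have := RingHom.ker_isPrime (substFirst p n)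
  have := RingHom.ker_isPrime (evalZeroAt p)
  have hlt : RingHom.ker (substFirst p n) < RingHom.ker (evalZeroAt p) := by
    refine lt_of_le_of_ne (fun g hg => ?_) fun h => ?_
    · rw [RingHom.mem_ker] at hg ⊢
      rw [← evalZeroAt_substFirst p n, hg, map_zero]
    · have hmem : MvPolynomial.C (Polynomial.X : Polynomial K) ∈ RingHom.ker (evalZeroAt p) := by
        simp [evalZeroAt, RingHom.mem_ker]
      rw [← h, RingHom.mem_ker] at hmem
      simp [substFirst, algebraMap_eq] at hmem
  exact (le_height_ker_substFirst p n le_rfl).trans_lt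
    (Ideal.height_strict_mono_of_isPrime_of_isPrime hlt)

/-- Each zero of a system with finitely many zeros lies on a component of the zero locus of the
deformed system that is not contained in `ε = 0`. -/
theorem exists_isPrime_deform_le [IsAlgClosed K] (d : Fin n → ℕ)
    (f : Fin n → MvPolynomial (Fin n) K) (hfin : {p : Fin n → K | ∀ i, eval p (f i) = 0}.Finite)
    (p : Fin n → K) (hp : ∀ i, eval p (f i) = 0) :
    ∃ P : Ideal (MvPolynomial (Fin n) (Polynomial K)), P.IsPrime ∧
      Ideal.span (Set.range (deform d f)) ≤ P ∧ P ≤ RingHom.ker (evalZeroAt p) ∧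
      MvPolynomial.C Polynomial.X ∉ P := by
  have hprime := RingHom.ker_isPrime (evalZeroAt p)
  have hle : Ideal.span (Set.range (deform d f)) ≤ RingHom.ker (evalZeroAt p) := by
    rw [Ideal.span_le]
    rintro _ ⟨i, rfl⟩
    simp [RingHom.mem_ker, evalZeroAt_deform, hp]
  obtain ⟨P, hP, hPm⟩ := Ideal.exists_minimalPrimes_le hle
  have hPprime : P.IsPrime := hP.1.1
  refine ⟨P, hPprime, hP.1.2, hPm, fun hX => ?_⟩
  have hf (i) : MvPolynomial.map C (f i) ∈ P := by
    have h1 : deform d f i ∈ P := hP.1.2 (Ideal.subset_span ⟨i, rfl⟩)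
    rw [deform, MvPolynomial.smul_eq_C_mul] at h1
    exact (Submodule.sub_mem_iff_right P (P.mul_mem_right _ hX)).1 h1
  have hspan : Ideal.span (Set.range f) ≤ P.comap (MvPolynomial.map C) := by
    rw [Ideal.span_le]
    rintro _ ⟨i, rfl⟩
    exact hf i
  have hcoord (i) : MvPolynomial.X i - MvPolynomial.C (C (p i)) ∈ P := by
    have h1 : ∏ q ∈ hfin.toFinset, (MvPolynomial.X i - MvPolynomial.C (q i)) ∈
        (Ideal.span (Set.range f)).radical := by
      rw [← vanishingIdeal_zeroLocus_eq_radical (K := K), mem_vanishingIdeal_iff]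
      intro x hx
      rw [map_prod, Finset.prod_eq_zero (i := x)]
      · rw [Set.Finite.mem_toFinset]
        intro i
        simpa using hx (f i) (Ideal.subset_span ⟨i, rfl⟩)
      · simp
    have h2 := (Ideal.IsPrime.radical_le_iff inferInstance).2 hspan h1
    rw [Ideal.IsPrime.prod_mem_iff] at h2
    obtain ⟨q, -, hq⟩ := h2
    rw [Ideal.mem_comap, map_sub, map_X, map_C] at hq
    have h3 := hPm hq
    have h4 : p i = q i := by simpa [RingHom.mem_ker, evalZeroAt, sub_eq_zero] using h3
    rwa [h4]
  have hker : RingHom.ker (evalZeroAt p) ≤ P := by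
    have h1 (g : MvPolynomial (Fin n) (Polynomial K)) :
        g - MvPolynomial.C (C (evalZeroAt p g)) ∈ P := by
      have : (Ideal.Quotient.mk P) = ((Ideal.Quotient.mk P).comp
          (MvPolynomial.C.comp C)).comp (evalZeroAt p) := by
        refine MvPolynomial.ringHom_ext (fun r => ?_) fun i => ?_
        · refine Ideal.Quotient.eq.2 (?_ : MvPolynomial.C r -
            MvPolynomial.C (C (evalZeroAt p (MvPolynomial.C r))) ∈ P)
          have h2 : evalZeroAt p (MvPolynomial.C r) = r.coeff 0 := by simp [evalZeroAt]
          rw [h2, ← map_sub]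
          obtain ⟨r', hr'⟩ : Polynomial.X ∣ r - C (r.coeff 0) := by simp [Polynomial.X_dvd_iff]
          rw [hr', map_mul]
          exact P.mul_mem_right _ hX
        · refine Ideal.Quotient.eq.2 (?_ : MvPolynomial.X i -
            MvPolynomial.C (C (evalZeroAt p (MvPolynomial.X i))) ∈ P)
          simpa [evalZeroAt] using hcoord i
      rw [← Ideal.Quotient.eq]
      exact DFunLike.congr_fun this g
    intro g hg
    simpa [(RingHom.mem_ker).1 hg] using h1 g
  have hP' : P = RingHom.ker (evalZeroAt p) := le_antisymm hPm hker
  have hh := Ideal.height_le_card_of_mem_minimalPrimes_span (Set.finite_range _) hP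
  rw [hP'] at hh
  have hn : (Set.range (deform d f)).ncard ≤ n := by
    rw [← Set.image_univ]
    exact (Set.ncard_image_le Set.finite_univ).trans (by simp)
  exact absurd (hh.trans (Nat.cast_le.2 hn)) (lt_height_ker_evalZeroAt p).not_ge

/-- A linear form separating finitely many points. -/
theorem exists_linear_injOn [Infinite K] {S : Set (Fin n → K)} (hS : S.Finite) :
    ∃ t : Fin n → K, S.InjOn fun p => ∑ i, t i * p i := by
  classical
  let G (x : Fin n → K) : Polynomial K := ∑ i : Fin n, Polynomial.monomial (i : ℕ) (x i)
  have hG {x} (hx : x ≠ 0) : G x ≠ 0 := fun h => hx <| by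
    ext j
    simpa [G, Polynomial.finsetSum_coeff, Polynomial.coeff_monomial, Fin.val_inj] using
      congrArg (fun p => Polynomial.coeff p j) h
  have hprod : ∏ q ∈ hS.toFinset.offDiag, G (q.1 - q.2) ≠ 0 :=
    Finset.prod_ne_zero_iff.2 fun q hq => hG (sub_ne_zero.2 (Finset.mem_offDiag.1 hq).2.2)
  obtain ⟨t, ht⟩ : ∃ t, Polynomial.eval t (∏ q ∈ hS.toFinset.offDiag, G (q.1 - q.2)) ≠ 0 := by
    by_contra! h
    exact hprod (Polynomial.funext fun t => by simpa using h t)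
  refine ⟨fun i => t ^ (i : ℕ), fun p hp q hq hpq => ?_⟩
  by_contra hne
  rw [Polynomial.eval_prod, Finset.prod_ne_zero_iff] at ht
  refine ht (p, q) (by simpa using ⟨hp, hq, hne⟩) ?_
  simp only at hpq
  simp only [G, Polynomial.eval_finsetSum, Polynomial.eval_monomial, Pi.sub_apply, sub_mul,
    Finset.sum_sub_distrib, sub_eq_zero]
  simpa only [mul_comm] using hpq

/-- **Affine Bézout bound**: `n` polynomials in `n` variables of degrees at most `dᵢ` with finitely
many common zeros have at most `∏ dᵢ` common zeros. -/
theorem ncard_zeros_le_prod [IsAlgClosed K] (d : Fin n → ℕ)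
    (f : Fin n → MvPolynomial (Fin n) K) (hf : ∀ i, (f i).totalDegree ≤ d i)
    (hfin : {p : Fin n → K | ∀ i, eval p (f i) = 0}.Finite) :
    {p : Fin n → K | ∀ i, eval p (f i) = 0}.ncard ≤ ∏ i, d i := by
  classical
  have : Infinite K := IsAlgClosed.instInfinite
  obtain ⟨t, ht⟩ := exists_linear_injOn hfin
  let u : MvPolynomial (Fin n) (Polynomial K) :=
    MvPolynomial.map C (∑ i, MvPolynomial.C (t i) * MvPolynomial.X i)
  have hu (p : Fin n → K) : evalZeroAt p u = ∑ i, t i * p i := by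
    rw [evalZeroAt_map]
    simp
  obtain ⟨c, hc0, hcdeg, hc⟩ := exists_aeval_mem_span_deform d f hf u
  obtain ⟨a, c', hc', rfl⟩ := WfDvdMonoid.max_power_factor hc0
    (Polynomial.prime_C_iff.2 (Polynomial.prime_X (R := K))).irreducible
  have hmap : c'.map Polynomial.constantCoeff ≠ 0 := by
    refine fun h => hc' ((Polynomial.C_dvd_iff_dvd_coeff _ _).2 fun i => ?_)
    rw [Polynomial.X_dvd_iff]
    simpa using congrArg (fun p => Polynomial.coeff p i) h
  have hdeg : (c'.map Polynomial.constantCoeff).natDegree ≤ ∏ i, d i := by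
    refine Polynomial.natDegree_map_le.trans (le_trans ?_ hcdeg)
    rw [← Polynomial.C_pow, Polynomial.natDegree_C_mul (pow_ne_zero _ Polynomial.X_ne_zero)]
  have hroot (p) (hp : ∀ i, eval p (f i) = 0) :
      ∑ i, t i * p i ∈ (c'.map Polynomial.constantCoeff).roots.toFinset := by
    obtain ⟨P, hP, hle, hPm, hX⟩ := exists_isPrime_deform_le d f hfin p hp
    have h1 := hle hc
    rw [map_mul, map_pow, Polynomial.aeval_C, algebraMap_eq] at h1
    have h2 := (hP.mem_or_mem h1).resolve_left fun h => hX (hP.mem_of_pow_mem _ h)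
    have h3 := (RingHom.mem_ker).1 (hPm h2)
    rw [Multiset.mem_toFinset, Polynomial.mem_roots hmap, Polynomial.IsRoot, ← hu,
      Polynomial.eval_map]
    rw [Polynomial.aeval_def, Polynomial.hom_eval₂] at h3
    have h4 : (evalZeroAt p).comp (algebraMap _ _) = Polynomial.constantCoeff :=
      RingHom.ext fun r => by simp [evalZeroAt, algebraMap_eq]
    rwa [h4] at h3
  calc _ ≤ ((c'.map Polynomial.constantCoeff).roots.toFinset : Set K).ncard :=
        Set.ncard_le_ncard_of_injOn _ (fun p hp => hroot p hp) ht (Finset.finite_toSet _)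
    _ ≤ (c'.map Polynomial.constantCoeff).natDegree := by
        rw [Set.ncard_coe_finset]
        exact (Multiset.toFinset_card_le _).trans (Polynomial.card_roots' _)
    _ ≤ _ := hdeg

end BezoutBound

theorem gaussMoment_map {α β : Type*} [CommRing α] [CommRing β] (φ : α →+* β) (μ v : α) :
    ∀ i, φ (gaussMoment i μ v) = gaussMoment i (φ μ) (φ v)
  | 0 => by simp [gaussMoment]
  | 1 => by simp [gaussMoment]
  | i + 2 => by simp [gaussMoment, gaussMoment_map φ μ v i, gaussMoment_map φ μ v (i + 1)]

open MvPolynomial in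
theorem totalDegree_gaussMoment_le {σ R : Type*} [CommRing R] (l : σ) (v : R) :
    ∀ i, (gaussMoment i (X l : MvPolynomial σ R) (C v)).totalDegree ≤ i
  | 0 => by simp [gaussMoment]
  | 1 => by
    rw [gaussMoment, X]
    exact (totalDegree_monomial_le _ _).trans (by simp)
  | i + 2 => by
    have hX : (X l : MvPolynomial σ R).totalDegree ≤ 1 :=
      (totalDegree_monomial_le _ _).trans (by simp)
    have hC : (((i : MvPolynomial σ R) + 1) * C v) = C (((i : R) + 1) * v) := by simp
    have h1 := totalDegree_gaussMoment_le l v i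
    have h2 := totalDegree_gaussMoment_le l v (i + 1)
    rw [gaussMoment, hC]
    refine (totalDegree_add _ _).trans (max_le ?_ ?_)
    · exact (totalDegree_mul _ _).trans (by omega)
    · exact (totalDegree_mul _ _).trans (by rw [totalDegree_C]; omega)

/-- If the solution set of the λ-weighted known-variance Gaussian `k`-mixture moment system
given by the first `k` moments is finite, then it has at most `k!` elements. -/
theorem knownVariance_solution_bound (k : ℕ) (hk : 1 ≤ k)
    (lam : Fin k → ℂ) (s : Fin k → ℂ) (m : Fin k → ℂ)
    (S : Set (Fin k → ℂ))
    (hS : S = {μ | ∀ i : Fin k,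
      ∑ ℓ, lam ℓ * gaussMoment (i.1 + 1) (μ ℓ) (s ℓ) = m i})
    (hfin : S.Finite) :
    Nat.card S ≤ k.factorial := by
  let f (i : Fin k) : MvPolynomial (Fin k) ℂ :=
    ∑ l, MvPolynomial.C (lam l) * gaussMoment (i.1 + 1) (MvPolynomial.X l) (MvPolynomial.C (s l)) -
      MvPolynomial.C (m i)
  have hf (i) : (f i).totalDegree ≤ i.1 + 1 := by
    refine (MvPolynomial.totalDegree_sub _ _).trans (max_le ?_ (by simp))
    refine MvPolynomial.totalDegree_finsetSum_le fun l _ => ?_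
    refine (MvPolynomial.totalDegree_mul _ _).trans ?_
    simpa using totalDegree_gaussMoment_le l (s l) (i.1 + 1)
  have hSf : S = {μ | ∀ i, MvPolynomial.eval μ (f i) = 0} := by
    rw [hS]
    ext μ
    simp [f, gaussMoment_map, sub_eq_zero]
  have hprod : ∏ i : Fin k, (i.1 + 1) = k.factorial := by
    rw [Fin.prod_univ_eq_prod_range (fun i => i + 1), Finset.prod_range_add_one_eq_factorial]
  rw [Nat.card_coe_set_eq, ← hprod, hSf]
  rw [hSf] at hfin
  exact BezoutBound.ncard_zeros_le_prod _ f hf hfin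
end

section
/- Fix k ≥ 1 and set m̄_i = (1/k) Σ_{j=1}^k M_i(j, 1) for i = 1, …, k (the moments of the uniform mixture of k Gaussians with means 1, 2, …, k and common variance 1). Let S ⊆ ℂ^k be the set of tuples (μ_1, …, μ_k) satisfying the k moment equations (1/k) Σ_{ℓ=1}^k M_i(μ_ℓ, 1) = m̄_i for i = 1, …, k. Then S is exactly the set of permutations of (1, 2, …, k), i.e. S = { (τ(1), τ(2), …, τ(k)) : τ a permutation of {1,…,k} }, and in particular S has exactly k! elements. -/
open Finset in
/-- Functions with equal power sums in degrees up to `N` have equal elementary symmetric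
functions in these degrees. -/
theorem aeval_esymm_eq_of_sum_pow_eq {ι K : Type*} [Fintype ι] [Field K] [CharZero K]
    {f g : ι → K} {N : ℕ} (h : ∀ n ≤ N, ∑ i, f i ^ n = ∑ i, g i ^ n) :
    ∀ n ≤ N, MvPolynomial.aeval f (MvPolynomial.esymm ι K n) =
      MvPolynomial.aeval g (MvPolynomial.esymm ι K n) := by
  classical
  intro n
  induction n using Nat.strong_induction_on with
  | _ n ih =>
    intro hn
    rcases Nat.eq_zero_or_pos n with rfl | hpos
    · simp
    have newton (u : ι → K) := congrArg (MvPolynomial.aeval u) (MvPolynomial.mul_esymm_eq_sum ι K n)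
    simp only [map_mul, map_natCast, map_sum, map_pow, map_neg, map_one, MvPolynomial.psum,
      MvPolynomial.aeval_X] at newton
    refine mul_left_cancel₀ (Nat.cast_ne_zero.mpr hpos.ne' : (n : K) ≠ 0) ?_
    rw [newton f, newton g]
    congr 1
    refine sum_congr rfl fun a ha => ?_
    simp only [mem_filter, HasAntidiagonal.mem_antidiagonal] at ha
    rw [ih a.1 ha.2 (by lia), h a.2 (by lia)]

/-- Functions on a finite type taking the same multiset of values agree up to a permutation. -/
theorem exists_perm_of_map_univ_eq {ι α : Type*} [Fintype ι] {f g : ι → α}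
    (h : Finset.univ.val.map f = Finset.univ.val.map g) : ∃ σ : Equiv.Perm ι, f = g ∘ σ := by
  classical
  have fiber (c : α) : Nonempty ({i // f i = c} ≃ {i // g i = c}) := by
    have hc := congrArg (Multiset.count c) h
    simp only [Multiset.count_map, ← Finset.filter_val, Finset.card_val, eq_comm (a := c)] at hc
    exact ⟨Fintype.equivOfCardEq (by simpa only [Fintype.card_subtype] using hc)⟩
  exact ⟨Equiv.ofFiberEquiv fun c => (fiber c).some,
    funext fun i => (Equiv.ofFiberEquiv_map _ i).symm⟩

/-- Over a field of characteristic zero, functions on a finite type with equal power sums agree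
up to a permutation. -/
theorem exists_perm_of_sum_pow_eq {ι K : Type*} [Fintype ι] [Field K] [CharZero K]
    {f g : ι → K} (h : ∀ n ≤ Fintype.card ι, ∑ i, f i ^ n = ∑ i, g i ^ n) :
    ∃ σ : Equiv.Perm ι, f = g ∘ σ := by
  refine exists_perm_of_map_univ_eq ?_
  rw [← Polynomial.roots_multiset_prod_X_sub_C (Finset.univ.val.map f),
    ← Polynomial.roots_multiset_prod_X_sub_C (Finset.univ.val.map g),
    Multiset.prod_X_sub_X_eq_sum_esymm, Multiset.prod_X_sub_X_eq_sum_esymm]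
  simp only [Multiset.card_map, ← MvPolynomial.aeval_esymm_eq_multiset_esymm ι K]
  congr 1
  refine Finset.sum_congr rfl fun n hn => ?_
  rw [aeval_esymm_eq_of_sum_pow_eq h n (Nat.lt_succ_iff.mp (Finset.mem_range.mp hn))]

theorem mul_gaussMoment {α : Type*} [CommRing α] (n : ℕ) (x v : α) :
    x * gaussMoment n x v = gaussMoment (n + 1) x v - n * v * gaussMoment (n - 1) x v := by
  cases n <;> simp [gaussMoment]

/-- Equal sums of Gaussian moments up to order `N` force equal power sums up to order `N`. -/
theorem sum_pow_eq_of_sum_gaussMoment_eq {ι α : Type*} [Fintype ι] [CommRing α] {f g : ι → α}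
    {v : α} {N : ℕ}
    (h : ∀ n ≤ N, ∑ i, gaussMoment n (f i) v = ∑ i, gaussMoment n (g i) v) :
    ∀ n ≤ N, ∑ i, f i ^ n = ∑ i, g i ^ n := by
  have key (m : ℕ) : ∀ n, n + m ≤ N →
      ∑ i, f i ^ m * gaussMoment n (f i) v = ∑ i, g i ^ m * gaussMoment n (g i) v := by
    induction m with
    | zero => simpa using h
    | succ m ih =>
      intro n hn
      have expand (u : ι → α) : ∑ i, u i ^ (m + 1) * gaussMoment n (u i) v =
          ∑ i, u i ^ m * gaussMoment (n + 1) (u i) v -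
            n * v * ∑ i, u i ^ m * gaussMoment (n - 1) (u i) v := by
        rw [Finset.mul_sum, ← Finset.sum_sub_distrib]
        refine Finset.sum_congr rfl fun i _ => ?_
        rw [pow_succ, mul_assoc, mul_gaussMoment]
        ring
      rw [expand, expand, ih (n + 1) (by lia), ih (n - 1) (by lia)]
  intro n hn
  simpa [gaussMoment] using key n 0 (by lia)

/-- For the uniform mixture of `k` Gaussians with means `1, 2, …, k` and common variance `1`,
the solution set of the first `k` moment equations is exactly the set of permutations of
`(1, 2, …, k)`; in particular it has exactly `k!` elements. -/
theorem uniform_mixture_solutions_are_permutations (k : ℕ) (hk : 1 ≤ k)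
    (S : Set (Fin k → ℂ))
    (hS : S = {μ | ∀ i : Fin k,
      (1 / (k : ℂ)) * ∑ ℓ, gaussMoment (i.1 + 1) (μ ℓ) 1 =
      (1 / (k : ℂ)) * ∑ j : Fin k, gaussMoment (i.1 + 1) ((j.1 + 1 : ℕ) : ℂ) 1}) :
    S = {μ | ∃ τ : Equiv.Perm (Fin k), μ = fun ℓ => (((τ ℓ).1 + 1 : ℕ) : ℂ)} ∧
      Nat.card S = k.factorial := by
  have hk0 : (1 / (k : ℂ)) ≠ 0 := one_div_ne_zero (Nat.cast_ne_zero.mpr (by lia))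
  have hS' : S = {μ | ∃ τ : Equiv.Perm (Fin k), μ = fun ℓ => (((τ ℓ).1 + 1 : ℕ) : ℂ)} := by
    rw [hS]
    ext μ
    refine ⟨fun h => ?_, ?_⟩
    · refine exists_perm_of_sum_pow_eq (g := fun j : Fin k => ((j.1 + 1 : ℕ) : ℂ)) ?_
      rw [Fintype.card_fin]
      refine sum_pow_eq_of_sum_gaussMoment_eq (v := 1) fun n hn => ?_
      cases n with
      | zero => simp [gaussMoment]
      | succ n => exact mul_left_cancel₀ hk0 (h ⟨n, hn⟩)
    · rintro ⟨τ, rfl⟩ i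
      rw [Equiv.sum_comp τ fun j : Fin k => gaussMoment (i.1 + 1) ((j.1 + 1 : ℕ) : ℂ) 1]
  refine ⟨hS', ?_⟩
  have hinj : Function.Injective
      fun (τ : Equiv.Perm (Fin k)) (ℓ : Fin k) => (((τ ℓ).1 + 1 : ℕ) : ℂ) := by
    intro σ τ h
    ext ℓ
    simpa using congrFun h ℓ
  have hrange : S = Set.range
      fun (τ : Equiv.Perm (Fin k)) (ℓ : Fin k) => (((τ ℓ).1 + 1 : ℕ) : ℂ) := by
    rw [hS']
    ext μ
    simp only [Set.mem_ofPred_eq, Set.mem_range, eq_comm]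
  rw [hrange, ← Nat.card_congr (Equiv.ofInjective _ hinj), Nat.card_perm, Nat.card_fin]
end
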